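/- Let {g_n} be a sequence of real-valued functions g_n: ℝ → ℝ such that: (1) each g_n is strictly monotonic; (2) for every y ∈ ℝ and ε > 0 there exist δ̄(ε) ∈ ℝ∖{0} (independent of n) and N(δ̄,ε) ∈ ℕ such that n > N(δ̄,ε) implies [g_n(y)−ε, g_n(y)+ε] ⊂ [g_n(y−δ̄(ε)), g_n(y+δ̄(ε))]; (3) for every ξ > 0 there is ε > 0 with 0 < |δ̄(ε)| < ξ. Then for every b ∈ ℝ and every real sequence (a_n): if a_n − g_n(b) → 0 as n → ∞, then g_n⁻¹(a_n) → b as n → ∞. -/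

import Mathlib

open Filter

theorem mem_uIcc_of_map_mem_uIcc {α β : Type*} [LinearOrder α] [LinearOrder β] {f : α → β}
    (hf : StrictMono f ∨ StrictAnti f) {x p q : α} (h : f x ∈ Set.uIcc (f p) (f q)) :
    x ∈ Set.uIcc p q := by
  rw [Set.mem_uIcc] at h ⊢
  rcases hf with hf | hf
  · simpa only [hf.le_iff_le] using h
  · simp only [hf.le_iff_ge] at h
    tauto

/-- Lemma on convergence of inverse function values.
Let `g n : ℝ → ℝ` be strictly monotonic functions satisfying conditions (2) and (3)
(with `δ̄(ε)` depending on `y` and `ε` but not on `n`; `Set.uIcc` is the closed interval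
between two reals irrespective of order).  Then for every `b ∈ ℝ` and real sequence
`a n`: if `a n − g n b → 0` then `g n ⁻¹ (a n) → b`.  (The values `x n = g n ⁻¹ (a n)`
of the inverse are characterised by `g n (x n) = a n`, since each `g n` is injective.) -/
theorem inverse_values_tendsto_of_sub_tendsto_zero
    (g : ℕ → ℝ → ℝ)
    (hmono : ∀ n, StrictMono (g n) ∨ StrictAnti (g n))
    -- conditions (2) and (3)
    (hcond23 : ∀ y : ℝ, ∃ δbar : ℝ → ℝ,
      (∀ ε > (0 : ℝ), δbar ε ≠ 0 ∧ ∃ N : ℕ, ∀ n > N,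
        Set.Icc (g n y - ε) (g n y + ε) ⊆
          Set.uIcc (g n (y - δbar ε)) (g n (y + δbar ε))) ∧
      (∀ ξ > (0 : ℝ), ∃ ε > (0 : ℝ), 0 < |δbar ε| ∧ |δbar ε| < ξ)) :
    ∀ b : ℝ, ∀ a : ℕ → ℝ,
      Tendsto (fun n => a n - g n b) atTop (nhds 0) →
      ∀ x : ℕ → ℝ, (∀ n, g n (x n) = a n) →
        Tendsto x atTop (nhds b) := by
  intro b a hab x hx
  obtain ⟨δbar, hδ, hsmall⟩ := hcond23 b
  rw [Metric.tendsto_atTop'] at hab ⊢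
  intro ξ hξ
  obtain ⟨ε, hε, -, hεξ⟩ := hsmall ξ hξ
  obtain ⟨-, N, hN⟩ := hδ ε hε
  obtain ⟨M, hM⟩ := hab ε hε
  refine ⟨max N M, fun n hn => ?_⟩
  have hclose := hM n ((le_max_right N M).trans_lt hn)
  rw [Real.dist_eq, sub_zero, abs_lt] at hclose
  have hmem : g n (x n) ∈ Set.Icc (g n b - ε) (g n b + ε) := by
    rw [hx n]
    constructor <;> linarith
  have hxmem := mem_uIcc_of_map_mem_uIcc (hmono n)
    (hN n ((le_max_left N M).trans_lt hn) hmem)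
  rw [Real.dist_eq, abs_lt]
  rw [abs_lt] at hεξ
  rw [Set.mem_uIcc] at hxmem
  rcases hxmem with h | h <;> constructor <;> linarith
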